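/- Let ν, μ ∈ ℂ and 0 < x < 1. Then P_ν^{-μ}(x) = 2^μ (1+x)^{-μ} · ∑_{n=0}^∞ ((-1)^n (2μ)_n (-ν)_n / n!) · ((1-x)/(1+x))^{n/2} · P_{μ+ν}^{-μ-n}(x), the series converging. -/

import Mathlib

noncomputable def pochC (a : ℂ) (n : ℕ) : ℂ := (ascPochhammer ℂ n).eval a

/-- Ferrers function of the first kind `P_ν^μ(x)`. -/
noncomputable def ferrersP (ν μ : ℂ) (x : ℝ) : ℂ :=
  (((1 + x) / (1 - x) : ℝ) : ℂ) ^ (μ / 2) *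
    ∑' n : ℕ, pochC (-ν) n * pochC (ν + 1) n /
        (Complex.Gamma ((n : ℂ) + 1 - μ) * (n.factorial : ℂ)) *
      (((1 - x) / 2 : ℝ) : ℂ) ^ n

section Hypergeometric

open Finset Filter Topology

lemma pochC_zero (a : ℂ) : pochC a 0 = 1 := by simp [pochC]

lemma pochC_succ (a : ℂ) (n : ℕ) : pochC a (n + 1) = pochC a n * (a + n) := by
  simp [pochC, ascPochhammer_succ_eval]

lemma pochC_add (a : ℂ) (n k : ℕ) : pochC a (n + k) = pochC a n * pochC (a + n) k := by
  simp [pochC, ← ascPochhammer_mul]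

lemma pochC_succ_left (a : ℂ) (n : ℕ) : pochC a (n + 1) = a * pochC (a + 1) n := by
  simp [pochC, ascPochhammer_succ_left]

lemma norm_pochC_le {a : ℂ} {r : ℝ} (h : ‖a‖ ≤ r) (n : ℕ) : ‖pochC a n‖ ≤ ‖pochC r n‖ := by
  induction n with
  | zero => simp [pochC_zero]
  | succ n ih =>
    have hn : ‖a + n‖ ≤ ‖(r : ℂ) + n‖ := by
      have h0 : (0 : ℝ) ≤ r + n := add_nonneg ((norm_nonneg a).trans h) n.cast_nonneg
      calc ‖a + n‖ ≤ ‖a‖ + ‖(n : ℂ)‖ := norm_add_le _ _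
        _ ≤ r + n := by simpa using h
        _ = ‖(r : ℂ) + n‖ := by
          rw [← Complex.ofReal_natCast, ← Complex.ofReal_add, Complex.norm_of_nonneg h0]
    rw [pochC_succ, pochC_succ, norm_mul, norm_mul]
    gcongr

lemma inv_Gamma_eq_pochC_mul (c : ℂ) (n : ℕ) :
    (Complex.Gamma c)⁻¹ = pochC c n * (Complex.Gamma (c + n))⁻¹ := by
  induction n with
  | zero => simp [pochC_zero]
  | succ n ih =>
    rw [ih, pochC_succ, Complex.one_div_Gamma_eq_self_mul_one_div_Gamma_add_one (c + n)]
    push_cast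
    rw [add_assoc, mul_assoc]

/-- A Pascal-type recurrence for a two-index array gives a recurrence for its antidiagonal sums. -/
lemma succ_mul_sum_antidiagonal_of_recurrence {T u v : ℕ → ℕ → ℂ}
    (hl : ∀ j : ℕ, (j + 1 : ℂ) * T 0 (j + 1) = v 0 j * T 0 j)
    (hr : ∀ k : ℕ, (k + 1 : ℂ) * T (k + 1) 0 = u k 0 * T k 0)
    (h : ∀ k j : ℕ, (k + j + 2 : ℂ) * T (k + 1) (j + 1) =
      u k (j + 1) * T k (j + 1) + v (k + 1) j * T (k + 1) j) (m : ℕ) :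
    (m + 1 : ℂ) * ∑ p ∈ antidiagonal (m + 1), T p.1 p.2 =
      ∑ p ∈ antidiagonal m, (u p.1 p.2 + v p.1 p.2) * T p.1 p.2 := by
  let U : ℕ × ℕ → ℂ := fun p => Nat.casesOn p.1 0 fun k => u k p.2 * T k p.2
  let V : ℕ × ℕ → ℂ := fun p => Nat.casesOn p.2 0 fun j => v p.1 j * T p.1 j
  have hUV : ∀ p ∈ antidiagonal (m + 1), (m + 1 : ℂ) * T p.1 p.2 = U p + V p := by
    rintro ⟨k, j⟩ hp
    rw [HasAntidiagonal.mem_antidiagonal] at hp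
    have hm : (m + 1 : ℂ) = k + j := by exact_mod_cast hp.symm
    rw [hm]
    rcases k with _ | k <;> rcases j with _ | j
    · simp at hp
    · simpa [U, V] using hl j
    · simpa [U, V] using hr k
    · simp only [U, V]
      rw [← h]
      push_cast
      ring
  rw [mul_sum, sum_congr rfl hUV, sum_add_distrib, Nat.sum_antidiagonal_succ,
    Nat.sum_antidiagonal_succ' (f := V)]
  simp [U, V, add_mul, sum_add_distrib]

/-- The Pfaff–Saalschütz identity. -/
lemma sum_antidiagonal_saalschutz (p q c : ℂ) (m : ℕ) :
    ∑ x ∈ antidiagonal m, pochC p x.1 * pochC q x.1 * pochC (c + x.1) x.2 *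
        pochC (c - p - q) x.2 / (x.1.factorial * x.2.factorial) =
      pochC (c - p) m * pochC (c - q) m / m.factorial := by
  induction m with
  | zero => simp [pochC_zero]
  | succ m ih =>
    have key := succ_mul_sum_antidiagonal_of_recurrence
      (T := fun k j => pochC p k * pochC q k * pochC (c + k) j * pochC (c - p - q) j /
        (k.factorial * j.factorial))
      (u := fun k _ => (p + k) * (q + k)) (v := fun k j => (c + 2 * k + j) * (c - p - q + j))
      (fun j => by
        have := Nat.cast_add_one_ne_zero (R := ℂ) j
        simp [pochC_zero, pochC_succ, Nat.factorial_succ]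
        field_simp)
      (fun k => by
        have := Nat.cast_add_one_ne_zero (R := ℂ) k
        simp [pochC_zero, pochC_succ, Nat.factorial_succ]
        field_simp)
      (fun k j => by
        have hk := Nat.cast_add_one_ne_zero (R := ℂ) k
        have hj := Nat.cast_add_one_ne_zero (R := ℂ) j
        have hkf : (k.factorial : ℂ) ≠ 0 := by exact_mod_cast k.factorial_ne_zero
        have hjf : (j.factorial : ℂ) ≠ 0 := by exact_mod_cast j.factorial_ne_zero
        simp only [pochC_succ_left (c + k) j, pochC_succ _ k, pochC_succ (c - p - q) j,
          pochC_succ (c + (k + 1 : ℕ)) j, Nat.factorial_succ]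
        push_cast
        rw [add_assoc c (k : ℂ) 1]
        field_simp
        ring) m
    have hm := Nat.cast_add_one_ne_zero (R := ℂ) m
    refine mul_left_cancel₀ hm (key.trans ?_)
    rw [sum_congr rfl (g := fun x => (c - p + m) * (c - q + m) *
      (pochC p x.1 * pochC q x.1 * pochC (c + x.1) x.2 * pochC (c - p - q) x.2 /
        (x.1.factorial * x.2.factorial))), ← mul_sum, ih]
    · rw [pochC_succ, pochC_succ, Nat.factorial_succ]
      push_cast
      field_simp
    · intro x hx
      rw [← HasAntidiagonal.mem_antidiagonal.mp hx]
      push_cast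
      ring

/-- A form of the Chu–Vandermonde identity. -/
lemma sum_antidiagonal_chu_vandermonde (b d : ℂ) (m : ℕ) :
    ∑ x ∈ antidiagonal m, (-1) ^ x.1 * pochC b x.1 * pochC (b + d + x.1) x.2 /
        (x.1.factorial * x.2.factorial) = pochC d m / m.factorial := by
  induction m with
  | zero => simp [pochC_zero]
  | succ m ih =>
    have key := succ_mul_sum_antidiagonal_of_recurrence
      (T := fun k j => (-1) ^ k * pochC b k * pochC (b + d + k) j /
        (k.factorial * j.factorial))
      (u := fun k _ => -(b + k)) (v := fun k j => b + d + 2 * k + j)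
      (fun j => by
        have := Nat.cast_add_one_ne_zero (R := ℂ) j
        simp [pochC_zero, pochC_succ, Nat.factorial_succ]
        field_simp)
      (fun k => by
        have := Nat.cast_add_one_ne_zero (R := ℂ) k
        simp [pochC_zero, pochC_succ, Nat.factorial_succ, pow_succ]
        field_simp
        ring)
      (fun k j => by
        have hk := Nat.cast_add_one_ne_zero (R := ℂ) k
        have hj := Nat.cast_add_one_ne_zero (R := ℂ) j
        have hkf : (k.factorial : ℂ) ≠ 0 := by exact_mod_cast k.factorial_ne_zero
        have hjf : (j.factorial : ℂ) ≠ 0 := by exact_mod_cast j.factorial_ne_zero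
        simp only [pochC_succ_left (b + d + k) j, pochC_succ _ k,
          pochC_succ (b + d + (k + 1 : ℕ)) j, Nat.factorial_succ, pow_succ]
        push_cast
        rw [add_assoc (b + d) (k : ℂ) 1]
        field_simp
        ring) m
    have hm := Nat.cast_add_one_ne_zero (R := ℂ) m
    refine mul_left_cancel₀ hm (key.trans ?_)
    rw [sum_congr rfl (g := fun x => (d + m) *
      ((-1) ^ x.1 * pochC b x.1 * pochC (b + d + x.1) x.2 /
        (x.1.factorial * x.2.factorial))), ← mul_sum, ih]
    · rw [pochC_succ, Nat.factorial_succ]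
      push_cast
      field_simp
    · intro x hx
      rw [← HasAntidiagonal.mem_antidiagonal.mp hx]
      push_cast
      ring

/-- The `n`-th term of the regularized hypergeometric series `₂F₁(p, q; c; z) / Γ(c)`. -/
noncomputable def regHypTerm (p q c z : ℂ) (n : ℕ) : ℂ :=
  pochC p n * pochC q n / (Complex.Gamma (c + n) * n.factorial) * z ^ n

lemma summable_regHypTerm (p q c : ℂ) {z : ℂ} (hz : ‖z‖ < 1) :
    Summable (regHypTerm p q c z) := by
  obtain ⟨r, hzr, hr⟩ := exists_between hz
  have hlim : Tendsto (fun n : ℕ => (p + 1 * n) / (c + 1 * n) * ((q + 1 * n) / (1 + 1 * n)) * z)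
      atTop (𝓝 (1 / 1 * (1 / 1) * z)) :=
    ((tendsto_add_mul_div_add_mul_atTop_nhds p c 1 one_ne_zero).mul
      (tendsto_add_mul_div_add_mul_atTop_nhds q 1 1 one_ne_zero)).mul_const z
  have hev := hlim.norm.eventually_le_const (u := r) (by simpa using hzr)
  have hne : ∀ᶠ n : ℕ in atTop, c + n ≠ 0 := by
    filter_upwards [eventually_gt_atTop ⌈‖c‖⌉₊] with n hn h0
    have hc : ‖c‖ = n := by rw [eq_neg_of_add_eq_zero_left h0]; simp
    exact absurd (Nat.lt_of_ceil_lt hn) (by simp [hc])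
  refine summable_of_ratio_norm_eventually_le hr ?_
  filter_upwards [hev, hne] with n hn hcn
  have hstep : regHypTerm p q c z (n + 1) =
      (p + 1 * n) / (c + 1 * n) * ((q + 1 * n) / (1 + 1 * n)) * z * regHypTerm p q c z n := by
    have hn1 := Nat.cast_add_one_ne_zero (R := ℂ) n
    unfold regHypTerm
    rw [Nat.cast_add_one, ← add_assoc, Complex.Gamma_add_one _ hcn, pochC_succ, pochC_succ,
      Nat.factorial_succ]
    push_cast
    rw [add_comm (1 : ℂ) (1 * n)]
    simp only [one_mul, div_eq_mul_inv, mul_inv]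
    ring
  rw [hstep, norm_mul]
  gcongr

lemma summable_norm_regHypTerm (p q c : ℂ) {z : ℂ} (hz : ‖z‖ < 1) :
    Summable fun n => ‖regHypTerm p q c z n‖ :=
  (summable_regHypTerm p q c hz).norm

lemma hasSum_one_sub_cpow_neg (s : ℂ) {z : ℂ} (hz : ‖z‖ < 1) :
    HasSum (fun n : ℕ => pochC s n / n.factorial * z ^ n) ((1 - z) ^ (-s)) := by
  have h := (Complex.one_div_one_sub_cpow_hasFPowerSeriesOnBall_zero s).hasSum
    (y := z) (by simpa [← ofReal_norm] using hz)
  simp only [zero_add, one_div, ← Complex.cpow_neg] at h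
  convert! h using 2 with n
  have hn : (n.factorial : ℂ) ≠ 0 := by exact_mod_cast n.factorial_ne_zero
  have hp := Ring.factorial_nsmul_multichoose_eq_ascPochhammer s n
  rw [Polynomial.ascPochhammer_smeval_eq_eval, nsmul_eq_mul, Ring.multichoose_eq] at hp
  rw [FormalMultilinearSeries.ofScalars_apply_eq, pochC, ← hp, mul_div_cancel_left₀ _ hn,
    smul_eq_mul]

lemma summable_norm_pochC_div_factorial_mul_pow (s : ℂ) {z : ℂ} (hz : ‖z‖ < 1) :
    Summable fun n : ℕ => ‖pochC s n / n.factorial * z ^ n‖ := by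
  refine (summable_norm_regHypTerm s 1 1 hz).congr fun n => ?_
  have h1 : pochC 1 n = n.factorial := by
    simp [pochC, ascPochhammer_eval_one]
  have h2 : (n.factorial : ℂ) ≠ 0 := by exact_mod_cast n.factorial_ne_zero
  rw [regHypTerm, h1, add_comm 1, Complex.Gamma_nat_eq_factorial, mul_div_mul_right _ _ h2]

/-- Euler's transformation of the regularized hypergeometric series. -/
lemma one_sub_cpow_mul_tsum_regHypTerm (p q c : ℂ) {z : ℂ} (hz : ‖z‖ < 1) :
    (1 - z) ^ (-(c - p - q)) * ∑' n, regHypTerm p q c z n =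
      ∑' n, regHypTerm (c - p) (c - q) c z n := by
  rw [← (hasSum_one_sub_cpow_neg (c - p - q) hz).tsum_eq, mul_comm,
    tsum_mul_tsum_eq_tsum_sum_antidiagonal_of_summable_norm (summable_norm_regHypTerm p q c hz)
      (summable_norm_pochC_div_factorial_mul_pow _ hz)]
  refine tsum_congr fun m => ?_
  have := sum_antidiagonal_saalschutz p q c m
  calc _ = ∑ x ∈ antidiagonal m, pochC p x.1 * pochC q x.1 * pochC (c + x.1) x.2 *
        pochC (c - p - q) x.2 / (x.1.factorial * x.2.factorial) *
        ((Complex.Gamma (c + m))⁻¹ * z ^ m) := by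
        refine sum_congr rfl fun x hx => ?_
        rw [← HasAntidiagonal.mem_antidiagonal.mp hx, regHypTerm, pow_add, Nat.cast_add,
          ← add_assoc, div_eq_mul_inv _ (Complex.Gamma _ * _), mul_inv, inv_Gamma_eq_pochC_mul (c + x.1) x.2]
        ring
    _ = _ := by
        rw [← sum_mul, this, regHypTerm]
        simp only [div_eq_mul_inv, mul_inv]
        ring

lemma summable_choose_mul {a : ℕ → ℝ} (ha : ∀ m, 0 ≤ a m) (h : Summable fun m => 2 ^ m * a m) :
    Summable fun x : ℕ × ℕ => (x.1 + x.2).choose x.1 * a (x.1 + x.2) := by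
  rw [← HasAntidiagonal.sigmaAntidiagonalEquivProd.summable_iff]
  refine (summable_sigma_of_nonneg fun x => mul_nonneg (Nat.cast_nonneg _) (ha _)).mpr
    ⟨fun m => (hasSum_fintype _).summable, h.congr fun m => ?_⟩
  rw [tsum_fintype]
  change _ = ∑ x : antidiagonal m, (((x.1.1 + x.1.2).choose x.1.1 : ℝ) * a (x.1.1 + x.1.2))
  rw [sum_coe_sort (antidiagonal m)
    (fun x : ℕ × ℕ => (((x.1 + x.2).choose x.1 : ℝ) * a (x.1 + x.2)))]
  rw [sum_congr rfl (g := fun x : ℕ × ℕ => (m.choose x.1 : ℝ) * a m)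
    (fun x hx => by rw [HasAntidiagonal.mem_antidiagonal.mp hx]), ← sum_mul,
    Nat.sum_antidiagonal_eq_sum_range_succ_mk, ← Nat.cast_sum, Nat.sum_range_choose]
  simp

/-- Expansion of a regularized hypergeometric series in series with all parameters shifted. -/
lemma hasSum_regHypTerm_expansion (b d e c : ℂ) {z : ℂ} (hz : ‖z‖ < 1 / 2) :
    HasSum (fun n : ℕ => (-1) ^ n * pochC b n * pochC e n / n.factorial * z ^ n *
      ∑' k, regHypTerm (b + d + n) (e + n) (c + n) z k) (∑' m, regHypTerm e d c z m) := by
  let F : ℕ × ℕ → ℂ := fun x => (-1) ^ x.1 * pochC b x.1 * pochC e x.1 / x.1.factorial * z ^ x.1 *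
    regHypTerm (b + d + x.1) (e + x.1) (c + x.1) z x.2
  have hF : ∀ x : ℕ × ℕ, F x = (-1) ^ x.1 * pochC b x.1 * pochC (b + d + x.1) x.2 /
      (x.1.factorial * x.2.factorial) * (pochC e (x.1 + x.2) *
        (Complex.Gamma (c + (x.1 + x.2 : ℕ)))⁻¹ * z ^ (x.1 + x.2)) := by
    intro x
    simp only [F, regHypTerm, pochC_add e, Nat.cast_add, ← add_assoc, pow_add, div_eq_mul_inv,
      mul_inv]
    ring
  let N : ℝ := max ‖b‖ ‖b + d‖
  have hN (x : ℕ × ℕ) : ‖pochC b x.1 * pochC (b + d + x.1) x.2‖ ≤ ‖pochC N (x.1 + x.2)‖ := by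
    rw [pochC_add, norm_mul, norm_mul]
    gcongr
    · exact norm_pochC_le (le_max_left _ _) _
    · have : ‖b + d + x.1‖ ≤ N + x.1 := (norm_add_le _ _).trans (by simp [N])
      exact_mod_cast norm_pochC_le this x.2
  have hsum : Summable F := by
    have h2 : ‖2 * z‖ < 1 := by rw [norm_mul]; norm_num; linarith
    have ha : Summable fun m => 2 ^ m * ‖regHypTerm e N c z m‖ := by
      refine (summable_norm_regHypTerm e N c h2).congr fun m => ?_
      simp only [regHypTerm, mul_pow, norm_mul, norm_pow, Complex.norm_two]
      ring
    refine Summable.of_norm_bounded (summable_choose_mul (fun _ => norm_nonneg _) ha) fun x => ?_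
    have hch : (((x.1 + x.2).choose x.1 : ℕ) : ℝ) * ((x.1 + x.2).factorial : ℝ)⁻¹ =
        (x.1.factorial * x.2.factorial : ℝ)⁻¹ := by
      rw [Nat.cast_add_choose]
      field_simp
    calc ‖F x‖ = ‖pochC b x.1 * pochC (b + d + x.1) x.2‖ * (x.1.factorial * x.2.factorial : ℝ)⁻¹ *
          ‖pochC e (x.1 + x.2) * (Complex.Gamma (c + (x.1 + x.2 : ℕ)))⁻¹ * z ^ (x.1 + x.2)‖ := by
          rw [hF]
          simp only [norm_mul, norm_inv, norm_pow, norm_neg, norm_one, one_pow, one_mul,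
            Complex.norm_natCast, div_eq_mul_inv]
      _ ≤ ‖pochC N (x.1 + x.2)‖ * (x.1.factorial * x.2.factorial : ℝ)⁻¹ *
          ‖pochC e (x.1 + x.2) * (Complex.Gamma (c + (x.1 + x.2 : ℕ)))⁻¹ * z ^ (x.1 + x.2)‖ := by
          gcongr
          exact hN x
      _ = _ := by
          rw [← hch]
          simp only [regHypTerm, norm_mul, norm_inv, Complex.norm_natCast,
            div_eq_mul_inv, mul_inv]
          ring
  have hinner (n : ℕ) : HasSum (fun k => F (n, k)) ((-1) ^ n * pochC b n * pochC e n /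
      n.factorial * z ^ n * ∑' k, regHypTerm (b + d + n) (e + n) (c + n) z k) :=
    (summable_regHypTerm (b + d + n) (e + n) (c + n) (hz.trans one_half_lt_one)).hasSum.mul_left
      ((-1) ^ n * pochC b n * pochC e n / n.factorial * z ^ n)
  have hrow := hsum.hasSum.prod_fiberwise hinner
  have hdiag := (HasAntidiagonal.sigmaAntidiagonalEquivProd.hasSum_iff.mpr hsum.hasSum).sigma
    fun m => hasSum_fintype _
  convert! hrow using 1
  rw [← hdiag.tsum_eq]
  refine tsum_congr fun m => ?_
  change _ = ∑ x : antidiagonal m, F x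
  rw [sum_coe_sort (antidiagonal m) F]
  rw [sum_congr rfl (fun x hx => by rw [hF, HasAntidiagonal.mem_antidiagonal.mp hx]), ← sum_mul,
    sum_antidiagonal_chu_vandermonde]
  simp only [regHypTerm, div_eq_mul_inv, mul_inv]
  ring

lemma ferrersP_neg_eq (ν μ : ℂ) (x : ℝ) : ferrersP ν (-μ) x =
    (((1 + x) / (1 - x) : ℝ) : ℂ) ^ (-μ / 2) *
      ∑' n, regHypTerm (-ν) (ν + 1) (μ + 1) (((1 - x) / 2 : ℝ) : ℂ) n := by
  unfold ferrersP regHypTerm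
  congr! 7
  ring

end Hypergeometric

theorem stmt12 (ν μ : ℂ) (x : ℝ) (h0 : 0 < x) (h1 : x < 1) :
    Summable (fun n : ℕ => (-1 : ℂ) ^ n * pochC (2 * μ) n * pochC (-ν) n / (n.factorial : ℂ) *
        (((1 - x) / (1 + x) : ℝ) : ℂ) ^ ((n : ℂ) / 2) * ferrersP (μ + ν) (-μ - n) x) ∧
      ferrersP ν (-μ) x =
        (2 : ℂ) ^ μ * ((1 + x : ℝ) : ℂ) ^ (-μ) *
          ∑' n : ℕ, (-1 : ℂ) ^ n * pochC (2 * μ) n * pochC (-ν) n / (n.factorial : ℂ) *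
            (((1 - x) / (1 + x) : ℝ) : ℂ) ^ ((n : ℂ) / 2) * ferrersP (μ + ν) (-μ - n) x := by
  have hA : (0 : ℝ) < 1 + x := by linarith
  have hB : (0 : ℝ) < 1 - x := by linarith
  set z : ℂ := (((1 - x) / 2 : ℝ) : ℂ) with hz
  have hznorm : ‖z‖ < 1 / 2 := by
    rw [hz, Complex.norm_of_nonneg (by linarith)]
    linarith
  set C : ℂ := (((1 + x) / (1 - x) : ℝ) : ℂ) ^ (-μ / 2) with hC
  set D : ℂ := (2 : ℂ) ^ μ * ((1 + x : ℝ) : ℂ) ^ (-μ) with hD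
  have hx2 : ((1 + x : ℝ) : ℂ) = 2 * (1 - z) := by rw [hz]; push_cast; ring
  have hz1 : 1 - z ≠ 0 := by
    intro h
    rw [h, mul_zero] at hx2
    exact hA.ne' (by exact_mod_cast hx2)
  have hDz : D = (1 - z) ^ (-μ) := by
    have h1z : 1 - z = (((1 + x) / 2 : ℝ) : ℂ) := by rw [hz]; push_cast; ring
    have h2 : (2 : ℂ) ^ μ * 2 ^ (-μ) = 1 := by
      rw [← Complex.cpow_add _ _ two_ne_zero, add_neg_cancel, Complex.cpow_zero]
    have h3 : ((1 + x : ℝ) : ℂ) = ((2 : ℝ) : ℂ) * (((1 + x) / 2 : ℝ) : ℂ) := by push_cast; ring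
    rw [hD, h1z, h3, Complex.mul_cpow_ofReal_nonneg zero_le_two (by linarith),
      Complex.ofReal_ofNat, ← mul_assoc, h2, one_mul]
  have hD0 : D ≠ 0 := by
    rw [hDz]
    simp [Complex.cpow_eq_zero_iff, hz1]
  have hw : (((1 - x) / (1 + x) : ℝ) : ℂ) = z / (1 - z) := by
    rw [Complex.ofReal_div, hx2, hz]; push_cast; field_simp
  have hterm (n : ℕ) : (-1 : ℂ) ^ n * pochC (2 * μ) n * pochC (-ν) n / (n.factorial : ℂ) *
      (((1 - x) / (1 + x) : ℝ) : ℂ) ^ ((n : ℂ) / 2) * ferrersP (μ + ν) (-μ - n) x =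
      C * D⁻¹ * ((-1) ^ n * pochC (2 * μ) n * pochC (-ν) n / n.factorial * z ^ n *
        ∑' k, regHypTerm (2 * μ + (ν + 1) + n) (-ν + n) (μ + 1 + n) z k) := by
    have heuler := one_sub_cpow_mul_tsum_regHypTerm (-(μ + ν)) (μ + ν + 1) (μ + n + 1)
      (z := z) (by linarith)
    have hpow : (((1 - x) / (1 + x) : ℝ) : ℂ) ^ ((n : ℂ) / 2) *
        (((1 + x) / (1 - x) : ℝ) : ℂ) ^ (-(μ + n) / 2) = C * (z / (1 - z)) ^ n := by
      have hpos : 0 < (1 + x) / (1 - x) := by positivity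
      have hne : (((1 + x) / (1 - x) : ℝ) : ℂ) ≠ 0 := by exact_mod_cast hpos.ne'
      have harg : (((1 + x) / (1 - x) : ℝ) : ℂ).arg ≠ Real.pi := by
        rw [Complex.arg_ofReal_of_nonneg hpos.le]
        exact Real.pi_pos.ne
      rw [← hw, ← Complex.cpow_natCast, hC,
        show ((1 - x) / (1 + x) : ℝ) = ((1 + x) / (1 - x))⁻¹ by rw [inv_div],
        Complex.ofReal_inv, Complex.inv_cpow _ _ harg, Complex.inv_cpow _ _ harg,
        ← Complex.cpow_neg, ← Complex.cpow_neg, ← Complex.cpow_add _ _ hne,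
        ← Complex.cpow_add _ _ hne]
      congr 1
      ring
    have hsub : (1 - z) ^ (-(μ + n + 1 - -(μ + ν) - (μ + ν + 1))) = D * ((1 - z) ^ n)⁻¹ := by
      rw [hDz, ← Complex.cpow_natCast, ← Complex.cpow_neg, ← Complex.cpow_add _ _ hz1]
      congr 1
      ring
    rw [hsub] at heuler
    have hparam : (2 * μ + (ν + 1) + n = μ + n + 1 - -(μ + ν)) ∧
        (-ν + n = μ + n + 1 - (μ + ν + 1)) ∧ (μ + 1 + n = μ + n + 1) := by
      refine ⟨?_, ?_, ?_⟩ <;> ring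
    rw [hparam.1, hparam.2.1, hparam.2.2, ← heuler, ← neg_add', ferrersP_neg_eq, ← hz,
      mul_assoc, ← mul_assoc (_ ^ ((n : ℂ) / 2)), hpow, div_pow]
    field_simp
  have hmain := (hasSum_regHypTerm_expansion (2 * μ) (ν + 1) (-ν) (μ + 1) hznorm).mul_left
    (C * D⁻¹)
  simp only [← hterm] at hmain
  refine ⟨hmain.summable, ?_⟩
  rw [hmain.tsum_eq, ferrersP_neg_eq, ← hz, ← hC]
  field_simp
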